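/- Let μ be a packed composition of type (k,n). Then there exists a polynomial Q ∈ K[x_1,…,x_n] of total degree |μ| − k such that f*_μ(x_1,…,x_n) = ∏_{i=1}^{k} (x_i − t^{−n+1}) · Q(x_1,…,x_n). -/

import Mathlib

open MvPolynomial

noncomputable section
open scoped Classical

/-- The field `K = ℚ(q,t)`. -/
abbrev K : Type := FractionRing (MvPolynomial (Fin 2) ℚ)

/-- The indeterminate `q` as an element of `K`. -/
def qq : K := algebraMap (MvPolynomial (Fin 2) ℚ) K (X 0)

/-- The indeterminate `t` as an element of `K`. -/
def tt : K := algebraMap (MvPolynomial (Fin 2) ℚ) K (X 1)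

/-- The size `|ν|` of a composition. -/
def csize {n : ℕ} (ν : Fin n → ℕ) : ℕ := ∑ i, ν i

/-- `k_i(ν) = #{j < i : ν_j > ν_i} + #{j > i : ν_j ≥ ν_i}`. -/
def kstat {n : ℕ} (ν : Fin n → ℕ) (i : Fin n) : ℕ :=
  Set.ncard {j : Fin n | j < i ∧ ν i < ν j} + Set.ncard {j : Fin n | i < j ∧ ν i ≤ ν j}

/-- The evaluation point `ν̃ = (q^{ν_i} t^{-k_i(ν)})_i`. -/
def evalPt {n : ℕ} (ν : Fin n → ℕ) : Fin n → K :=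
  fun i => qq ^ ν i * tt ^ (-(kstat ν i : ℤ))

/-- Weakly decreasing composition. -/
def IsPartition {n : ℕ} (l : Fin n → ℕ) : Prop := ∀ i j : Fin n, i ≤ j → l j ≤ l i

/-- The action `σ·μ := μ ∘ σ⁻¹`. -/
def permAct {n : ℕ} (σ : Equiv.Perm (Fin n)) (μ : Fin n → ℕ) : Fin n → ℕ := μ ∘ ⇑σ.symm

/-- `S_n(λ)`: the rearrangements of `λ`. -/
def Sn {n : ℕ} (l : Fin n → ℕ) : Set (Fin n → ℕ) :=
  {μ | ∃ σ : Equiv.Perm (Fin n), permAct σ l = μ}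

/-- The rearrangements of `λ` as a `Finset`. -/
def SnFinset {n : ℕ} (l : Fin n → ℕ) : Finset (Fin n → ℕ) :=
  Finset.image (fun σ : Equiv.Perm (Fin n) => permAct σ l) Finset.univ

/-- The exponent `Finsupp` of the monomial `x^μ`. -/
def expOf {n : ℕ} (μ : Fin n → ℕ) : Fin n →₀ ℕ := Finsupp.equivFunOnFinite.symm μ

/-- Characterization of the interpolation nonsymmetric Macdonald polynomial `E*_μ`. -/
def IsEstar {n : ℕ} (μ : Fin n → ℕ) (f : MvPolynomial (Fin n) K) : Prop :=
  f.totalDegree ≤ csize μ ∧ coeff (expOf μ) f = 1 ∧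
    ∀ ν : Fin n → ℕ, csize ν ≤ csize μ → ν ≠ μ → eval (evalPt ν) f = 0

/-- The interpolation nonsymmetric Macdonald polynomial `E*_μ` (unique by Knop–Sahi). -/
def Estar {n : ℕ} (μ : Fin n → ℕ) : MvPolynomial (Fin n) K :=
  if h : ∃ f, IsEstar μ f then h.choose else 0

/-- Characterization of the interpolation (symmetric) Macdonald polynomial `P*_λ`. -/
def IsPstar {n : ℕ} (l : Fin n → ℕ) (f : MvPolynomial (Fin n) K) : Prop :=
  f.IsSymmetric ∧ f.totalDegree ≤ csize l ∧ coeff (expOf l) f = 1 ∧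
    ∀ ν : Fin n → ℕ, IsPartition ν → csize ν ≤ csize l → ν ≠ l → eval (evalPt ν) f = 0

/-- The interpolation Macdonald polynomial `P*_λ`. -/
def Pstar {n : ℕ} (l : Fin n → ℕ) : MvPolynomial (Fin n) K :=
  if h : ∃ f, IsPstar l f then h.choose else 0

/-- The space `V*_λ`. -/
def Vstar {n : ℕ} (l : Fin n → ℕ) : Submodule K (MvPolynomial (Fin n) K) :=
  (restrictTotalDegree (Fin n) K (csize l)) ⊓
    ⨅ (ν : Fin n → ℕ) (_ : csize ν ≤ csize l ∧ ν ∉ Sn l),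
      LinearMap.ker (aeval (R := K) (evalPt ν)).toLinearMap

/-- Exchange of the variables `x_i` and `x_j` in a polynomial. -/
def swapVars {n : ℕ} (i j : Fin n) (f : MvPolynomial (Fin n) K) : MvPolynomial (Fin n) K :=
  rename (Equiv.swap i j) f

/-- Exact division of polynomials: the unique `g` with `a = b * g` when it exists. -/
def exactDiv {n : ℕ} (a b : MvPolynomial (Fin n) K) : MvPolynomial (Fin n) K :=
  if h : ∃ g, a = b * g then h.choose else 0

/-- The Hecke operator
`T f = t f − ((t x_i − x_j)/(x_i − x_j))·(f − s_i f)` (where `j = i+1`). -/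
def hecke {n : ℕ} (i j : Fin n) (f : MvPolynomial (Fin n) K) : MvPolynomial (Fin n) K :=
  C tt * f - (C tt * X i - X j) * exactDiv (f - swapVars i j f) (X i - X j)

/-- The Coxeter length of a permutation (number of inversions). -/
def permLength {n : ℕ} (σ : Equiv.Perm (Fin n)) : ℕ :=
  Set.ncard {p : Fin n × Fin n | p.1 < p.2 ∧ σ p.2 < σ p.1}

/-- The adjacent transposition `s_i = (i, i+1)` (0-indexed). -/
def adjSwap {n : ℕ} (i : {i : ℕ // i + 1 < n}) : Equiv.Perm (Fin n) :=
  Equiv.swap ⟨i.1, Nat.lt_of_succ_lt i.2⟩ ⟨i.1 + 1, i.2⟩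

/-- The Hecke operator `T_i` for an adjacent transposition index. -/
def heckeAt {n : ℕ} (i : {i : ℕ // i + 1 < n}) :
    MvPolynomial (Fin n) K → MvPolynomial (Fin n) K :=
  hecke ⟨i.1, Nat.lt_of_succ_lt i.2⟩ ⟨i.1 + 1, i.2⟩

/-- `T_{i_1} ⋯ T_{i_ℓ} f` for a word `w = [i_1, …, i_ℓ]`. -/
def Tword {n : ℕ} (w : List {i : ℕ // i + 1 < n}) (f : MvPolynomial (Fin n) K) :
    MvPolynomial (Fin n) K :=
  w.foldr heckeAt f

/-- `w` is a reduced word for `σ`. -/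
def IsReducedWordOf {n : ℕ} (w : List {i : ℕ // i + 1 < n}) (σ : Equiv.Perm (Fin n)) : Prop :=
  (w.map adjSwap).prod = σ ∧ w.length = permLength σ

/-- `T_σ`, computed from a reduced word of `σ` (independent of the choice, by the
Hecke algebra relations). -/
def Tsigma {n : ℕ} (σ : Equiv.Perm (Fin n)) :
    MvPolynomial (Fin n) K → MvPolynomial (Fin n) K :=
  if h : ∃ w, IsReducedWordOf w σ then Tword h.choose else id

/-- `σ_μ`: the (unique) shortest permutation with `σ·l = μ`. -/
def sigmaMin {n : ℕ} (l μ : Fin n → ℕ) : Equiv.Perm (Fin n) :=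
  if h : ∃ σ, permAct σ l = μ ∧ ∀ τ, permAct τ l = μ → permLength σ ≤ permLength τ then
    h.choose else 1

/-- The weakly decreasing rearrangement of a composition. -/
def sortDesc {n : ℕ} (μ : Fin n → ℕ) : Fin n → ℕ :=
  if h : ∃ l, IsPartition l ∧ μ ∈ Sn l then h.choose else μ

/-- The interpolation ASEP polynomial `f*_μ = T_{σ_μ} E*_λ`, where `λ` is the weakly
decreasing rearrangement of `μ`. -/
def fstar {n : ℕ} (μ : Fin n → ℕ) : MvPolynomial (Fin n) K :=
  Tsigma (sigmaMin (sortDesc μ) μ) (Estar (sortDesc μ))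

/-- The composition with entries `i` and `j` exchanged. -/
def swapEntries {n : ℕ} (i j : Fin n) (μ : Fin n → ℕ) : Fin n → ℕ := μ ∘ ⇑(Equiv.swap i j)
/-- `μ` is packed of type `(k,n)`: nonzero entries exactly in the first `k` positions. -/
def Packed {n : ℕ} (k : ℕ) (μ : Fin n → ℕ) : Prop :=
  ∀ i : Fin n, ((i : ℕ) < k → μ i ≠ 0) ∧ (k ≤ (i : ℕ) → μ i = 0)


/-! ### Interpolation -/

theorem kstat_eq_sum {n : ℕ} (ν : Fin n → ℕ) (i : Fin n) :
    kstat ν i = ∑ j, ((if j < i ∧ ν i < ν j then 1 else 0) +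
      (if i < j ∧ ν i ≤ ν j then 1 else 0)) := by
  unfold kstat
  rw [Finset.sum_add_distrib, Set.ncard_eq_toFinset_card', Set.ncard_eq_toFinset_card']
  simp only [Finset.card_eq_sum_ones, Finset.sum_ite, Finset.sum_const_zero, add_zero]
  congr 1 <;> (apply Finset.sum_congr _ (fun _ _ => rfl); ext; simp)

theorem kstat_cons_zero_zero {n : ℕ} (ν : Fin n → ℕ) :
    kstat (Fin.cons 0 ν : Fin (n+1) → ℕ) 0 = n := by
  rw [kstat_eq_sum, Fin.sum_univ_succ]
  simp

theorem kstat_cons_zero_succ {n : ℕ} (ν : Fin n → ℕ) (i : Fin n) :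
    kstat (Fin.cons 0 ν : Fin (n+1) → ℕ) i.succ = kstat ν i := by
  rw [kstat_eq_sum, kstat_eq_sum, Fin.sum_univ_succ]
  simp

theorem kstat_cons_snoc_zero {n : ℕ} (β : Fin n → ℕ) (a : ℕ) :
    kstat (Fin.cons (a+1) β : Fin (n+1) → ℕ) 0 =
      kstat (Fin.snoc β a : Fin (n+1) → ℕ) (Fin.last n) := by
  rw [kstat_eq_sum, kstat_eq_sum, Fin.sum_univ_succ, Fin.sum_univ_castSucc]
  simp [Fin.castSucc_lt_last, (Fin.castSucc_lt_last _).not_gt]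

theorem kstat_cons_snoc_succ {n : ℕ} (β : Fin n → ℕ) (a : ℕ) (i : Fin n) :
    kstat (Fin.cons (a+1) β : Fin (n+1) → ℕ) i.succ =
      kstat (Fin.snoc β a : Fin (n+1) → ℕ) i.castSucc := by
  rw [kstat_eq_sum, kstat_eq_sum, Fin.sum_univ_succ, Fin.sum_univ_castSucc]
  simp [Fin.castSucc_lt_last, (Fin.castSucc_lt_last _).not_gt, add_comm]

section interp
variable {R : Type*} [CommRing R]

/-- the evaluation point, with `u = t⁻¹`, over any ring. -/
def gpt (q u : R) {n : ℕ} (ν : Fin n → ℕ) : Fin n → R := fun i => q ^ ν i * u ^ kstat ν i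

theorem gpt_cons_zero (q u : R) {n : ℕ} (ν : Fin n → ℕ) :
    gpt q u (Fin.cons 0 ν : Fin (n+1) → ℕ) = Fin.cons (u ^ n) (gpt q u ν) := by
  funext i
  refine Fin.cases ?_ (fun i => ?_) i
  · simp [gpt, kstat_cons_zero_zero]
  · simp [gpt, kstat_cons_zero_succ]

/-- restriction to `x_0 = c` -/
def restr {n : ℕ} (c : R) (f : MvPolynomial (Fin (n+1)) R) : MvPolynomial (Fin n) R :=
  aeval (Fin.cons (C c) X : Fin (n+1) → MvPolynomial (Fin n) R) f

/-- `g(x_1,…,x_n, q⁻¹ x_0)` -/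
def rot {n : ℕ} (q : R) (f : MvPolynomial (Fin (n+1)) R) : MvPolynomial (Fin (n+1)) R :=
  aeval (Fin.snoc (fun i => X i.succ) (C q * X 0) : Fin (n+1) → MvPolynomial (Fin (n+1)) R) f

/-- inverse of `rot` -/
def unrot {n : ℕ} (q : R) (f : MvPolynomial (Fin (n+1)) R) : MvPolynomial (Fin (n+1)) R :=
  aeval (Fin.cons (C q * X (Fin.last n)) (fun i => X i.castSucc) :
    Fin (n+1) → MvPolynomial (Fin (n+1)) R) f

theorem totalDegree_aeval_le_of {σ τ : Type*} (s : σ → MvPolynomial τ R)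
    (hs : ∀ i, (s i).totalDegree ≤ 1) (f : MvPolynomial σ R) :
    (aeval s f).totalDegree ≤ f.totalDegree := by
  conv_lhs => rw [f.as_sum, map_sum]
  refine totalDegree_finsetSum_le fun m hm => ?_
  rw [aeval_monomial]
  refine (totalDegree_mul _ _).trans ?_
  rw [MvPolynomial.algebraMap_eq, totalDegree_C, zero_add]
  refine le_trans ?_ (le_totalDegree hm)
  unfold Finsupp.prod Finsupp.sum
  refine (totalDegree_finsetProd _ _).trans (Finset.sum_le_sum fun i _ => ?_)
  refine (totalDegree_pow _ _).trans ?_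
  simpa using Nat.mul_le_mul_left (m i) (hs i)

theorem totalDegree_C_mul_X_le {σ : Type*} (a : R) (i : σ) :
    (C a * X i : MvPolynomial σ R).totalDegree ≤ 1 := by
  rw [C_mul_X_eq_monomial]
  exact (totalDegree_monomial_le _ _).trans (by simp)

theorem totalDegree_X_le {σ : Type*} (i : σ) :
    (X i : MvPolynomial σ R).totalDegree ≤ 1 := by
  simpa using totalDegree_C_mul_X_le (1:R) i

theorem restr_degree {n : ℕ} (c : R) (f : MvPolynomial (Fin (n+1)) R) :
    (restr c f).totalDegree ≤ f.totalDegree := by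
  refine totalDegree_aeval_le_of _ (fun i => ?_) f
  refine Fin.cases ?_ (fun i => ?_) i
  · simp
  · simpa using totalDegree_X_le i

theorem rot_degree {n : ℕ} (c : R) (f : MvPolynomial (Fin (n+1)) R) :
    (rot c f).totalDegree ≤ f.totalDegree := by
  refine totalDegree_aeval_le_of _ (fun i => ?_) f
  refine Fin.lastCases ?_ (fun i => ?_) i
  · simpa using totalDegree_C_mul_X_le _ _
  · simpa using totalDegree_X_le _

theorem unrot_degree {n : ℕ} (c : R) (f : MvPolynomial (Fin (n+1)) R) :
    (unrot c f).totalDegree ≤ f.totalDegree := by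
  refine totalDegree_aeval_le_of _ (fun i => ?_) f
  refine Fin.cases ?_ (fun i => ?_) i
  · simpa using totalDegree_C_mul_X_le _ _
  · simpa using totalDegree_X_le _

theorem rot_unrot {n : ℕ} {q qi : R} (h : q * qi = 1) (f : MvPolynomial (Fin (n+1)) R) :
    rot qi (unrot q f) = f := by
  have : ((aeval (Fin.snoc (fun i => X i.succ) (C qi * X 0) :
      Fin (n+1) → MvPolynomial (Fin (n+1)) R)).comp
      (aeval (Fin.cons (C q * X (Fin.last n)) (fun i => X i.castSucc) :
      Fin (n+1) → MvPolynomial (Fin (n+1)) R))) = AlgHom.id R _ := by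
    ext1 i
    refine Fin.cases ?_ (fun i => ?_) i
    · rw [AlgHom.comp_apply, aeval_X, Fin.cons_zero, map_mul, aeval_X, Fin.snoc_last, aeval_C,
        MvPolynomial.algebraMap_eq, ← mul_assoc, ← C_mul, h, C_1, one_mul]
      rfl
    · rw [AlgHom.comp_apply, aeval_X, Fin.cons_succ, aeval_X, Fin.snoc_castSucc]
      rfl
  exact DFunLike.congr_fun this f

theorem eval_restr {n : ℕ} (c : R) (f : MvPolynomial (Fin (n+1)) R) (x : Fin n → R) :
    eval x (restr c f) = eval (Fin.cons c x : Fin (n+1) → R) f := by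
  unfold restr
  induction f using MvPolynomial.induction_on with
  | C a => simp
  | add p q hp hq => rw [map_add, map_add, map_add, hp, hq]
  | mul_X p i hp =>
    rw [map_mul, map_mul, map_mul, hp]
    refine Fin.cases ?_ (fun i => ?_) i <;> simp

theorem eval_rot {n : ℕ} (q qi u : R) (h : q * qi = 1) (g : MvPolynomial (Fin (n+1)) R)
    (β : Fin n → ℕ) (a : ℕ) :
    eval (gpt q u (Fin.cons (a+1) β : Fin (n+1) → ℕ)) (rot qi g) =
      eval (gpt q u (Fin.snoc β a : Fin (n+1) → ℕ)) g := by
  unfold rot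
  induction g using MvPolynomial.induction_on with
  | C a => simp
  | add p q hp hq => rw [map_add, map_add, map_add, hp, hq]
  | mul_X p i hp =>
    rw [map_mul, map_mul, map_mul, hp]
    congr 1
    refine Fin.lastCases ?_ (fun i => ?_) i
    · simp only [aeval_X, Fin.snoc_last, map_mul, eval_C, eval_X]
      simp only [gpt, kstat_cons_snoc_zero, Fin.cons_zero, Fin.snoc_last]
      rw [pow_succ]
      linear_combination (q ^ a * u ^ kstat (Fin.snoc β a : Fin (n+1) → ℕ) (Fin.last n)) * h
    · simp [gpt, kstat_cons_snoc_succ]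

theorem sub_dvd_of_restr {n : ℕ} (c : R) (f : MvPolynomial (Fin (n+1)) R) :
    (X 0 - C c) ∣ f - rename Fin.succ (restr c f) := by
  unfold restr
  induction f using MvPolynomial.induction_on with
  | C a => simp
  | add p q hp hq =>
    rw [map_add, map_add, add_sub_add_comm]; exact dvd_add hp hq
  | mul_X p i hp =>
    rw [map_mul, map_mul]
    refine Fin.cases ?_ (fun i => ?_) i
    · simp only [aeval_X, Fin.cons_zero, rename_C]
      obtain ⟨r, hr⟩ := hp
      exact ⟨r * C c + p, by linear_combination C c * hr⟩
    · simp only [aeval_X, Fin.cons_succ, rename_X]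
      rw [← sub_mul]
      exact hp.mul_right _

theorem csize_cons {n : ℕ} (a : ℕ) (β : Fin n → ℕ) :
    csize (Fin.cons a β : Fin (n+1) → ℕ) = a + csize β := by
  simp [csize, Fin.sum_univ_succ]

theorem csize_snoc {n : ℕ} (a : ℕ) (β : Fin n → ℕ) :
    csize (Fin.snoc β a : Fin (n+1) → ℕ) = csize β + a := by
  simp [csize, Fin.sum_univ_castSucc]

theorem csize_zero' {n : ℕ} : csize (0 : Fin n → ℕ) = 0 := by simp [csize]

theorem csize_eq_zero' {n : ℕ} {ν : Fin n → ℕ} (h : csize ν ≤ 0) : ν = 0 := by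
  simpa [csize, funext_iff] using h

/-- The genericity assumption. -/
def Gen (q u : R) : Prop := ∀ a b c : ℕ, IsUnit (q ^ (a+1) * u ^ b - u ^ c)

theorem exists_factor [IsDomain R] {q qi : R} (h : q * qi = 1) {n d : ℕ} (c : R)
    (f : MvPolynomial (Fin (n+1)) R) (hd : f.totalDegree ≤ d + 1) (hf : restr c f = 0) :
    ∃ g, g.totalDegree ≤ d ∧ f = (X 0 - C c) * rot qi g := by
  obtain ⟨r, hr⟩ := sub_dvd_of_restr c f
  rw [hf, map_zero, sub_zero] at hr
  refine ⟨unrot q r, (unrot_degree _ _).trans ?_, by rw [rot_unrot h, hr]⟩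
  by_cases h0 : r = 0
  · simp [h0]
  have h1 : (X 0 - C c : MvPolynomial (Fin (n+1)) R) ≠ 0 :=
    (MonomialOrder.monic_X_sub_C MonomialOrder.lex 0 c).ne_zero
  have h2 : 1 ≤ (X 0 - C c : MvPolynomial (Fin (n+1)) R).totalDegree := by
    have : (Finsupp.single 0 1 : Fin (n+1) →₀ ℕ) ∈ (X 0 - C c : MvPolynomial (Fin (n+1)) R).support := by
      rw [mem_support_iff, coeff_sub, coeff_X, coeff_C, if_pos rfl, if_neg]
      · simp
      · intro h; simpa using DFunLike.congr_fun h 0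
    simpa using le_totalDegree this
  rw [hr, totalDegree_mul_of_isDomain h1 h0] at hd
  omega

theorem eval_factor (q qi u : R) (h : q * qi = 1) {n : ℕ} (g : MvPolynomial (Fin (n+1)) R)
    (β : Fin n → ℕ) (a : ℕ) :
    eval (gpt q u (Fin.cons (a+1) β : Fin (n+1) → ℕ)) ((X 0 - C (u ^ n)) * rot qi g) =
      (q ^ (a+1) * u ^ (kstat (Fin.cons (a+1) β : Fin (n+1) → ℕ) 0) - u ^ n) *
      eval (gpt q u (Fin.snoc β a : Fin (n+1) → ℕ)) g := by
  rw [map_mul, eval_rot _ _ _ h]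
  simp [gpt]

theorem interp_unique [IsDomain R] {q qi u : R} (h : q * qi = 1) (hU : Gen q u) :
    ∀ (n d : ℕ) (f : MvPolynomial (Fin n) R), f.totalDegree ≤ d →
      (∀ ν, csize ν ≤ d → eval (gpt q u ν) f = 0) → f = 0 := by
  intro n
  induction n with
  | zero =>
    intro d f _ hf
    have := hf 0 (by simp [csize])
    rw [eq_C_of_isEmpty f, eval_C] at this
    rw [eq_C_of_isEmpty f, this, C_0]
  | succ n ihn =>
    intro d
    induction d with
    | zero =>
      intro f hd hf
      have h1 := totalDegree_eq_zero_iff_eq_C.mp (Nat.le_zero.mp hd)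
      have := hf 0 (by simp [csize])
      rw [h1, eval_C] at this
      rw [h1, this, C_0]
    | succ d ihd =>
      intro f hd hf
      have h0 : restr (u ^ n) f = 0 := by
        refine ihn (d+1) _ ((restr_degree _ _).trans hd) fun ν hν => ?_
        rw [eval_restr, ← gpt_cons_zero]
        exact hf _ (by rw [csize_cons]; omega)
      obtain ⟨g, hg, hfg⟩ := exists_factor h _ f hd h0
      have : g = 0 := by
        refine ihd g hg fun ω hω => ?_
        rw [← Fin.snoc_init_self ω] at hω ⊢
        rw [csize_snoc] at hω
        have := hf (Fin.cons (ω (Fin.last n) + 1) (Fin.init ω)) (by rw [csize_cons]; omega)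
        rw [hfg, eval_factor _ _ _ h] at this
        exact (hU _ _ _).mul_right_eq_zero.mp this
      rw [hfg, this]; simp [rot]

theorem interp_exists {q qi u : R} (h : q * qi = 1) (hU : Gen q u) :
    ∀ (n d : ℕ) (v : (Fin n → ℕ) → R), ∃ f : MvPolynomial (Fin n) R, f.totalDegree ≤ d ∧
      ∀ ν, csize ν ≤ d → eval (gpt q u ν) f = v ν := by
  intro n
  induction n with
  | zero =>
    intro d v
    refine ⟨C (v 0), by simp, fun ν _ => ?_⟩
    rw [Subsingleton.elim ν 0]; simp
  | succ n ihn =>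
    intro d
    induction d with
    | zero =>
      intro v
      refine ⟨C (v 0), by simp, fun ν hν => ?_⟩
      rw [csize_eq_zero' hν]; simp
    | succ d ihd =>
      intro v
      obtain ⟨f0, hd0, hf0⟩ := ihn (d+1) (fun ν => v (Fin.cons 0 ν))
      have key : ∀ ω : Fin (n+1) → ℕ, ∃ y : R,
          (q ^ (ω (Fin.last n) + 1) * u ^ (kstat (Fin.cons (ω (Fin.last n) + 1) (Fin.init ω) : Fin (n+1) → ℕ) 0) - u ^ n) * y =
          v (Fin.cons (ω (Fin.last n) + 1) (Fin.init ω)) -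
            eval (gpt q u (Fin.cons (ω (Fin.last n) + 1) (Fin.init ω) : Fin (n+1) → ℕ)) (rename Fin.succ f0) := by
        intro ω
        obtain ⟨y, hy⟩ := (hU (ω (Fin.last n)) (kstat (Fin.cons (ω (Fin.last n) + 1) (Fin.init ω) : Fin (n+1) → ℕ) 0) n).exists_right_inv
        exact ⟨y * _, by rw [← mul_assoc, hy, one_mul]⟩
      choose w hw using key
      obtain ⟨g, hdg, hg⟩ := ihd w
      refine ⟨rename Fin.succ f0 + (X 0 - C (u ^ n)) * rot qi g, ?_, fun ν hν => ?_⟩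
      · refine (totalDegree_add _ _).trans (max_le ((totalDegree_rename_le _ _).trans hd0) ?_)
        refine (totalDegree_mul _ _).trans ?_
        have h1 := rot_degree qi g
        have h2 : (X 0 - C (u ^ n) : MvPolynomial (Fin (n+1)) R).totalDegree ≤ 1 :=
          (totalDegree_sub_C_le _ _).trans (totalDegree_X_le _)
        omega
      · rw [← Fin.cons_self_tail ν] at hν ⊢
        rw [csize_cons] at hν
        rcases hν0 : ν 0 with _ | a
        · rw [gpt_cons_zero, map_add, map_mul, eval_rename]
          have : (Fin.cons (u ^ n) (gpt q u (Fin.tail ν)) : Fin (n+1) → R) ∘ Fin.succ = gpt q u (Fin.tail ν) := by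
            funext i; simp
          rw [this, hf0 _ (by omega)]
          simp
        · rw [map_add, eval_factor _ _ _ h, hg _ (by rw [csize_snoc]; omega)]
          have := hw (Fin.snoc (Fin.tail ν) a)
          rw [Fin.snoc_last, Fin.init_snoc] at this
          rw [this]; ring

/-- the product `∏_{i<k} (x_i - c)` -/
def prodk (n k : ℕ) (c : R) : MvPolynomial (Fin n) R :=
  ∏ i ∈ Finset.univ.filter (fun i : Fin n => (i : ℕ) < k), (X i - C c)

theorem prodk_succ (n k : ℕ) (hk : k ≤ n) (c qi : R) :
    prodk (n+1) (k+1) c = (X 0 - C c) * rot qi (prodk (n+1) k c) := by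
  unfold prodk rot
  rw [Finset.prod_filter, Finset.prod_filter, Fin.prod_univ_succ, map_prod, Fin.prod_univ_castSucc]
  simp [apply_ite, Nat.not_lt.mpr hk]

theorem interp_dvd [IsDomain R] {q qi u : R} (h : q * qi = 1) (hU : Gen q u) (n : ℕ) :
    ∀ (k d : ℕ) (f : MvPolynomial (Fin (n+1)) R), k ≤ n + 1 → f.totalDegree ≤ d →
      (∀ ν, csize ν ≤ d → (∃ i : Fin (n+1), (i:ℕ) < k ∧ ν i = 0) → eval (gpt q u ν) f = 0) →
      prodk (n+1) k (u ^ n) ∣ f := by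
  intro k
  induction k with
  | zero => intro d f _ _ _; simp [prodk]
  | succ k ih =>
    intro d f hk hd hf
    have h0 : restr (u ^ n) f = 0 := by
      refine interp_unique h hU n d _ ((restr_degree _ _).trans hd) fun ν hν => ?_
      rw [eval_restr, ← gpt_cons_zero]
      exact hf _ (by rw [csize_cons]; omega) ⟨0, by simp⟩
    rcases d with _ | d
    · have h1 := totalDegree_eq_zero_iff_eq_C.mp (Nat.le_zero.mp hd)
      have := hf 0 (by simp [csize]) ⟨0, by simp⟩
      rw [h1, eval_C] at this
      rw [h1, this, C_0]
      exact dvd_zero _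
    · obtain ⟨g, hg, hfg⟩ := exists_factor h _ f hd h0
      have : prodk (n+1) k (u ^ n) ∣ g := by
        refine ih d g (by omega) hg fun ω hω ⟨i, hi, hωi⟩ => ?_
        rw [← Fin.snoc_init_self ω] at hω ⊢
        rw [csize_snoc] at hω
        have := hf (Fin.cons (ω (Fin.last n) + 1) (Fin.init ω)) (by rw [csize_cons]; omega) (by
          refine ⟨Fin.succ ⟨i, by omega⟩, by simpa using hi, ?_⟩
          rw [Fin.cons_succ]
          exact hωi)
        rw [hfg, eval_factor _ _ _ h] at this
        exact (hU _ _ _).mul_right_eq_zero.mp this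
      rw [prodk_succ n k (by omega) _ qi, hfg]
      obtain ⟨r, rfl⟩ := this
      exact mul_dvd_mul_left _ ⟨rot qi r, by simp [rot]⟩

end interp

/-! ### Existence of `E*` -/

theorem gpt_map {R S : Type*} [CommRing R] [CommRing S] (φ : R →+* S) (q u : R) {n : ℕ}
    (ν : Fin n → ℕ) : gpt (φ q) (φ u) ν = φ ∘ gpt q u ν := by
  funext i; simp [gpt]

theorem eval_gpt_map {R S : Type*} [CommRing R] [CommRing S] (φ : R →+* S) (q u : R) {n : ℕ}
    (ν : Fin n → ℕ) (f : MvPolynomial (Fin n) R) :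
    eval (gpt (φ q) (φ u) ν) (map φ f) = φ (eval (gpt q u ν) f) := by
  rw [gpt_map, eval_map]
  exact (eval₂_comp _ _ _).symm

theorem totalDegree_map_le' {R S : Type*} [CommRing R] [CommRing S] (φ : R →+* S) {σ : Type*}
    (f : MvPolynomial σ R) : (map φ f).totalDegree ≤ f.totalDegree :=
  totalDegree_le_of_support_subset' φ f
where
  totalDegree_le_of_support_subset' (φ : R →+* S) (f : MvPolynomial σ R) :
      (map φ f).totalDegree ≤ f.totalDegree := by
    unfold totalDegree
    exact Finset.sup_mono (support_map_subset φ f)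

theorem Gen.map {R S : Type*} [CommRing R] [CommRing S] (φ : R →+* S) {q u : R} (h : Gen q u) :
    Gen (φ q) (φ u) := by
  intro a b c
  simpa using (h a b c).map φ

theorem gen_two : Gen (2 : ℚ) 1 := by
  intro a b c
  rw [isUnit_iff_ne_zero]
  have : (1:ℚ) < 2 ^ (a+1) := one_lt_pow₀ (by norm_num) (by omega)
  simp; linarith

/-- Lagrange product at `q = 2, t = 1`. -/
def lag {n : ℕ} (μ : Fin n → ℕ) : MvPolynomial (Fin n) ℚ :=
  ∏ i, ∏ j ∈ Finset.range (μ i), (X i - C (2 ^ j))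

theorem lag_degree {n : ℕ} (μ : Fin n → ℕ) : (lag μ).totalDegree ≤ csize μ := by
  unfold lag csize
  refine (totalDegree_finsetProd _ _).trans (Finset.sum_le_sum fun i _ => ?_)
  refine (totalDegree_finsetProd _ _).trans ?_
  refine (Finset.sum_le_sum (g := fun _ => 1) fun j _ => ?_).trans (by simp)
  exact (totalDegree_sub_C_le _ _).trans (totalDegree_X_le _)

theorem lag_coeff {n : ℕ} (μ : Fin n → ℕ) : coeff (expOf μ) (lag μ) = 1 := by
  have hm : (MonomialOrder.lex (σ := Fin n)).Monic (lag μ) :=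
    MonomialOrder.Monic.prod fun i _ => MonomialOrder.Monic.prod fun j _ =>
      MonomialOrder.monic_X_sub_C _ _ _
  have hd : (MonomialOrder.lex (σ := Fin n)).degree (lag μ) = expOf μ := by
    unfold lag
    rw [MonomialOrder.degree_prod]
    · have : ∀ i, (MonomialOrder.lex (σ := Fin n)).degree
          (∏ j ∈ Finset.range (μ i), (X i - C ((2:ℚ) ^ j))) = Finsupp.single i (μ i) := by
        intro i
        rw [MonomialOrder.degree_prod]
        · simp only [MonomialOrder.degree_X_sub_C]
          simp
        · intro j _
          exact (MonomialOrder.monic_X_sub_C MonomialOrder.lex _ _).ne_zero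
      simp only [this]
      exact Finsupp.univ_sum_single (expOf μ)
    · intro i _
      exact (MonomialOrder.Monic.prod (m := MonomialOrder.lex) fun j _ =>
        MonomialOrder.monic_X_sub_C _ _ _).ne_zero
  rw [← hd]; exact hm

theorem lag_eval {n : ℕ} (μ ν : Fin n → ℕ) (h : csize ν ≤ csize μ) (hne : ν ≠ μ) :
    eval (gpt (2:ℚ) 1 ν) (lag μ) = 0 := by
  obtain ⟨i, hi⟩ : ∃ i, ν i < μ i := by
    by_contra hc
    push Not at hc
    apply hne
    have := (Finset.sum_eq_sum_iff_of_le (s := Finset.univ) (fun i _ => hc i)).mp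
      (le_antisymm (Finset.sum_le_sum fun i _ => hc i) h)
    funext i; exact (this i (Finset.mem_univ i)).symm
  unfold lag
  rw [map_prod]
  apply Finset.prod_eq_zero (Finset.mem_univ i)
  rw [map_prod]
  apply Finset.prod_eq_zero (Finset.mem_range.mpr hi)
  simp [gpt]

theorem lead_two {n : ℕ} (μ : Fin n → ℕ) (f : MvPolynomial (Fin n) ℚ)
    (hd : f.totalDegree ≤ csize μ) (h1 : eval (gpt (2:ℚ) 1 μ) f = 1)
    (h0 : ∀ ν, csize ν ≤ csize μ → ν ≠ μ → eval (gpt (2:ℚ) 1 ν) f = 0) :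
    coeff (expOf μ) f ≠ 0 := by
  have key : lag μ - C (eval (gpt (2:ℚ) 1 μ) (lag μ)) * f = 0 := by
    apply interp_unique (q := (2:ℚ)) (qi := 1/2) (by norm_num) gen_two n (csize μ)
    · refine (totalDegree_sub _ _).trans (max_le (lag_degree μ) ?_)
      refine (totalDegree_mul _ _).trans ?_
      simpa using hd
    · intro ν hν
      by_cases hne : ν = μ
      · subst hne; simp [h1]
      · simp [lag_eval μ ν hν hne, h0 ν hν hne]
  intro hc
  have := congrArg (coeff (expOf μ)) key
  simp [lag_coeff, coeff_C_mul, hc] at this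

/-- specialization `q = 2, t = 1`. -/
def spec : MvPolynomial (Fin 2) ℚ →+* ℚ := eval ![2, 1]

/-- its kernel -/
def specP : Ideal (MvPolynomial (Fin 2) ℚ) := RingHom.ker spec

instance : specP.IsPrime := RingHom.ker_isPrime spec

/-- the local ring at `q = 2, t = 1` -/
abbrev LA : Type := Localization.AtPrime specP

theorem spec_ne {y : MvPolynomial (Fin 2) ℚ} (hy : y ∈ specP.primeCompl) : spec y ≠ 0 := hy

/-- `LA → ℚ` -/
def psi : LA →+* ℚ := IsLocalization.lift (M := specP.primeCompl) (S := LA) (g := spec)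
  (fun y => isUnit_iff_ne_zero.mpr (spec_ne y.2))

/-- `LA → K` -/
def theta : LA →+* K := IsLocalization.lift (M := specP.primeCompl) (S := LA)
  (g := algebraMap (MvPolynomial (Fin 2) ℚ) K)
  (fun y => isUnit_iff_ne_zero.mpr (by
    intro h
    have h2 : (y : MvPolynomial (Fin 2) ℚ) = 0 :=
      (map_eq_zero_iff _ (IsFractionRing.injective (MvPolynomial (Fin 2) ℚ) K)).mp h
    exact spec_ne y.2 (by rw [h2, map_zero])))

theorem psi_unit (a : LA) (h : psi a ≠ 0) : IsUnit a := by
  obtain ⟨x, s, rfl⟩ := IsLocalization.exists_mk'_eq specP.primeCompl a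
  have : spec x ≠ 0 := by
    intro hx
    apply h
    have h1 : algebraMap (MvPolynomial (Fin 2) ℚ) LA s * IsLocalization.mk' LA x s
        = algebraMap _ LA x := IsLocalization.mk'_spec' LA x s
    have h2 := congrArg psi h1
    rw [map_mul] at h2
    simp only [psi, IsLocalization.lift_eq] at h2
    rw [hx] at h2
    exact (mul_eq_zero.mp h2).resolve_left (spec_ne s.2)
  rw [IsLocalization.AtPrime.isUnit_mk'_iff LA specP]
  exact this

theorem exists_LA : ∃ q qi t u : LA, q * qi = 1 ∧ t * u = 1 ∧ psi q = 2 ∧ psi u = 1 ∧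
    theta q = qq ∧ theta t = tt := by
  have e0 : psi (algebraMap (MvPolynomial (Fin 2) ℚ) LA (X 0)) = 2 := by
    simp [psi, IsLocalization.lift_eq, spec]
  have e1 : psi (algebraMap (MvPolynomial (Fin 2) ℚ) LA (X 1)) = 1 := by
    simp [psi, IsLocalization.lift_eq, spec]
  obtain ⟨qi, hqi⟩ := (psi_unit _ (by rw [e0]; norm_num)).exists_right_inv
  obtain ⟨u, hu⟩ := (psi_unit _ (by rw [e1]; norm_num)).exists_right_inv
  refine ⟨_, qi, _, u, hqi, hu, e0, ?_, ?_, ?_⟩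
  · have := congrArg psi hu
    rwa [map_mul, e1, one_mul, map_one] at this
  · exact IsLocalization.lift_eq _ _
  · exact IsLocalization.lift_eq _ _

theorem evalPt_eq {n : ℕ} (ν : Fin n → ℕ) : evalPt ν = gpt qq tt⁻¹ ν := by
  funext i; simp [evalPt, gpt]

theorem K_data : (tt ≠ 0) ∧ (∃ qi : K, qq * qi = 1) ∧ Gen qq tt⁻¹ ∧
    ∀ (n : ℕ) (μ : Fin n → ℕ), ∃ f, IsEstar μ f := by
  obtain ⟨q, qi, t, u, hq, ht, pq, pu, tq, htt⟩ := exists_LA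
  have hgen : Gen q u := by
    intro a b c
    apply psi_unit
    have := gen_two a b c
    rw [isUnit_iff_ne_zero] at this
    simpa [pq, pu] using this
  have hK : tt * theta u = 1 := by rw [← htt, ← map_mul, ht, map_one]
  have hu : theta u = tt⁻¹ := (inv_eq_of_mul_eq_one_right hK).symm
  refine ⟨left_ne_zero_of_mul_eq_one hK, ⟨theta qi, by rw [← tq, ← map_mul, hq, map_one]⟩, ?_, ?_⟩
  · rw [← tq, ← hu]; exact hgen.map theta
  · intro n μ
    obtain ⟨h, hd, hv⟩ := interp_exists hq hgen n (csize μ) (fun ν => if ν = μ then 1 else 0)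
    have hc : psi (coeff (expOf μ) h) ≠ 0 := by
      rw [← coeff_map]
      apply lead_two μ (map psi h) ((totalDegree_map_le' _ _).trans hd)
      · have := eval_gpt_map psi q u μ h
        rw [pq, pu, hv μ le_rfl] at this
        simpa using this
      · intro ν hν hne
        have := eval_gpt_map psi q u ν h
        rw [pq, pu, hv ν hν] at this
        simpa [hne] using this
    have hc' : theta (coeff (expOf μ) h) ≠ 0 := ((psi_unit _ hc).map theta).ne_zero
    refine ⟨C (theta (coeff (expOf μ) h))⁻¹ * map theta h, ?_, ?_, ?_⟩
    · refine (totalDegree_mul _ _).trans ?_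
      rw [totalDegree_C, zero_add]
      exact (totalDegree_map_le' _ _).trans hd
    · rw [coeff_C_mul, coeff_map, inv_mul_cancel₀ hc']
    · intro ν hν hne
      rw [map_mul, evalPt_eq, ← tq, ← hu, eval_gpt_map, hv ν hν, if_neg hne, map_zero, mul_zero]

/-! ### Hecke operators -/
section heckesec
variable {n : ℕ}

theorem swap_dvd (i j : Fin n) (f : MvPolynomial (Fin n) K) :
    (X i - X j) ∣ f - swapVars i j f := by
  unfold swapVars
  induction f using MvPolynomial.induction_on with
  | C a => simp
  | add p q hp hq => rw [map_add, add_sub_add_comm]; exact dvd_add hp hq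
  | mul_X p l hp =>
    rw [map_mul, rename_X]
    have h2 : (X i - X j : MvPolynomial (Fin n) K) ∣ X l - X (Equiv.swap i j l) := by
      by_cases h1 : l = i
      · subst h1; simp
      · by_cases h2 : l = j
        · subst h2; rw [Equiv.swap_apply_right]; exact ⟨-1, by ring⟩
        · rw [Equiv.swap_apply_of_ne_of_ne h1 h2]; simp
    obtain ⟨r, hr⟩ := hp
    obtain ⟨r2, hr2⟩ := h2
    exact ⟨r * X l + rename (Equiv.swap i j) p * r2, by
      linear_combination X l * hr + rename (Equiv.swap i j) p * hr2⟩

/-- divided difference -/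
def dd (i j : Fin n) (f : MvPolynomial (Fin n) K) : MvPolynomial (Fin n) K :=
  exactDiv (f - swapVars i j f) (X i - X j)

theorem dd_spec (i j : Fin n) (f : MvPolynomial (Fin n) K) :
    f - swapVars i j f = (X i - X j) * dd i j f := by
  unfold dd exactDiv
  have h : ∃ g, f - swapVars i j f = (X i - X j) * g := swap_dvd i j f
  rw [dif_pos h]
  exact h.choose_spec

theorem X_sub_ne {i j : Fin n} (h : i ≠ j) : (X i - X j : MvPolynomial (Fin n) K) ≠ 0 := by
  rw [sub_ne_zero]
  exact fun h2 => h (X_injective h2)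

theorem hecke_eq (i j : Fin n) (f : MvPolynomial (Fin n) K) :
    hecke i j f = C tt * f - (C tt * X i - X j) * dd i j f := rfl

theorem swap_swap (i j : Fin n) (f : MvPolynomial (Fin n) K) :
    swapVars i j (swapVars i j f) = f := by
  unfold swapVars
  rw [rename_rename]
  convert rename_id_apply f
  funext x; simp

theorem swapVars_X_left (i j : Fin n) : swapVars i j (X i) = X j := by simp [swapVars]
theorem swapVars_X_right (i j : Fin n) : swapVars i j (X j) = X i := by simp [swapVars]

theorem swap_dd {i j : Fin n} (h : i ≠ j) (f : MvPolynomial (Fin n) K) :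
    swapVars i j (dd i j f) = dd i j f := by
  have h1 := dd_spec i j f
  have h2 := congrArg (swapVars i j) h1
  have h3 : swapVars i j f - f = (X j - X i) * swapVars i j (dd i j f) := by
    have e1 : swapVars i j (f - swapVars i j f) = swapVars i j f - f := by
      conv_rhs => rw [← swap_swap i j f]
      rw [swap_swap i j f]
      unfold swapVars
      rw [map_sub]
      congr 1
      exact swap_swap i j f
    rw [← e1, h2]
    unfold swapVars
    rw [map_mul, map_sub]
    simp
  apply mul_left_cancel₀ (X_sub_ne h)
  linear_combination h1 + h3

theorem hecke_mul_symm {i j : Fin n} (h : i ≠ j) (P f : MvPolynomial (Fin n) K)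
    (hP : swapVars i j P = P) : hecke i j (P * f) = P * hecke i j f := by
  have : dd i j (P * f) = P * dd i j f := by
    apply mul_left_cancel₀ (X_sub_ne h)
    rw [← dd_spec]
    have e : swapVars i j (P * f) = P * swapVars i j f := by
      conv_rhs => rw [← hP]
      unfold swapVars
      rw [map_mul]
    rw [e]
    linear_combination P * dd_spec i j f
  rw [hecke_eq, hecke_eq, this]; ring

theorem dd_hecke {i j : Fin n} (h : i ≠ j) (f : MvPolynomial (Fin n) K) :
    dd i j (hecke i j f) = - dd i j f := by
  apply mul_left_cancel₀ (X_sub_ne h)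
  rw [← dd_spec]
  have e : swapVars i j (hecke i j f) =
      C tt * swapVars i j f - (C tt * X j - X i) * dd i j f := by
    conv_rhs => rw [← swap_dd h f]
    rw [hecke_eq]
    unfold swapVars
    simp
  rw [e, hecke_eq]
  linear_combination C tt * dd_spec i j f

theorem dd_term_degree {i j : Fin n} (h : i ≠ j) (f : MvPolynomial (Fin n) K) :
    ((C tt * X i - X j) * dd i j f).totalDegree ≤ f.totalDegree := by
  by_cases h0 : dd i j f = 0
  · simp [h0]
  have h1 := congrArg totalDegree (dd_spec i j f)
  rw [totalDegree_mul_of_isDomain (X_sub_ne h) h0] at h1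
  have h2 : (f - swapVars i j f).totalDegree ≤ f.totalDegree :=
    (totalDegree_sub _ _).trans (max_le le_rfl (totalDegree_rename_le _ _))
  have h3 : 1 ≤ (X i - X j : MvPolynomial (Fin n) K).totalDegree := by
    have : (Finsupp.single i 1 : Fin n →₀ ℕ) ∈ (X i - X j : MvPolynomial (Fin n) K).support := by
      rw [mem_support_iff, coeff_sub, coeff_X, coeff_X, if_pos rfl, if_neg]
      · simp
      · intro hh
        exact h ((Finsupp.single_left_injective one_ne_zero) hh).symm
    simpa using le_totalDegree this
  have h4 : (C tt * X i - X j : MvPolynomial (Fin n) K).totalDegree ≤ 1 :=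
    (totalDegree_sub _ _).trans (max_le (totalDegree_C_mul_X_le _ _) (totalDegree_X_le _))
  have := totalDegree_mul (C tt * X i - X j) (dd i j f)
  omega

theorem C_mul_degree_le (a : K) (f : MvPolynomial (Fin n) K) :
    (C a * f).totalDegree ≤ f.totalDegree := by
  simpa using totalDegree_mul (C a) f

theorem hecke_degree {i j : Fin n} (h : i ≠ j) (f : MvPolynomial (Fin n) K) :
    (hecke i j f).totalDegree = f.totalDegree := by
  apply le_antisymm
  · rw [hecke_eq]
    exact (totalDegree_sub _ _).trans (max_le (C_mul_degree_le _ _) (dd_term_degree h f))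
  · have ht : tt⁻¹ * tt = 1 := inv_mul_cancel₀ K_data.1
    have e : f = C tt⁻¹ * (hecke i j f - (C tt * X i - X j) * dd i j (hecke i j f)) := by
      rw [dd_hecke h]
      have ht' : (C tt⁻¹ * C tt : MvPolynomial (Fin n) K) = 1 := by rw [← C_mul, ht, C_1]
      rw [hecke_eq]
      linear_combination (-f) * ht'
    conv_lhs => rw [e]
    refine (C_mul_degree_le _ _).trans ?_
    exact (totalDegree_sub _ _).trans (max_le le_rfl (dd_term_degree h _))

theorem prodk_swap (k : ℕ) (c : K) (i j : Fin n) (h : ((i:ℕ) < k) ↔ ((j:ℕ) < k)) :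
    swapVars i j (prodk n k c) = prodk n k c := by
  unfold swapVars prodk
  rw [map_prod]
  refine Finset.prod_bij (fun x _ => Equiv.swap i j x) ?_ ?_ ?_ ?_
  · intro x hx
    simp only [Finset.mem_filter, Finset.mem_univ, true_and] at hx ⊢
    by_cases h1 : x = i
    · subst h1; rw [Equiv.swap_apply_left]; exact h.mp hx
    · by_cases h2 : x = j
      · subst h2; rw [Equiv.swap_apply_right]; exact h.mpr hx
      · rwa [Equiv.swap_apply_of_ne_of_ne h1 h2]
  · intro a _ b _ hab
    exact (Equiv.swap i j).injective hab
  · intro x hx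
    refine ⟨Equiv.swap i j x, ?_, by simp⟩
    simp only [Finset.mem_filter, Finset.mem_univ, true_and] at hx ⊢
    by_cases h1 : x = i
    · subst h1; rw [Equiv.swap_apply_left]; exact h.mp hx
    · by_cases h2 : x = j
      · subst h2; rw [Equiv.swap_apply_right]; exact h.mpr hx
      · rwa [Equiv.swap_apply_of_ne_of_ne h1 h2]
  · intro x _
    simp

theorem Tword_prod (k : ℕ) (c : K) (w : List {i : ℕ // i + 1 < n})
    (hw : ∀ i ∈ w, i.1 + 1 ≠ k) (Q : MvPolynomial (Fin n) K) :
    Tword w (prodk n k c * Q) = prodk n k c * Tword w Q ∧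
      (Tword w Q).totalDegree = Q.totalDegree := by
  induction w with
  | nil => simp [Tword]
  | cons i w ih =>
    obtain ⟨h1, h2⟩ := ih fun x hx => hw x (List.mem_cons_of_mem _ hx)
    have hi := hw i List.mem_cons_self
    have hne : (⟨i.1, Nat.lt_of_succ_lt i.2⟩ : Fin n) ≠ ⟨i.1 + 1, i.2⟩ := by
      intro h; simpa using congrArg Fin.val h
    constructor
    · change heckeAt i (Tword w _) = _ * heckeAt i (Tword w _)
      rw [h1]
      refine hecke_mul_symm hne _ _ (prodk_swap k c _ _ ?_)
      simp only; omega
    · change (heckeAt i (Tword w _)).totalDegree = _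
      rw [← h2]
      exact hecke_degree hne _

end heckesec

/-! ### Reduced words -/
section words
variable {n : ℕ}

/-- the inversion set -/
def invSet (σ : Equiv.Perm (Fin n)) : Set (Fin n × Fin n) := {p | p.1 < p.2 ∧ σ p.2 < σ p.1}

theorem permLength_eq (σ : Equiv.Perm (Fin n)) : permLength σ = (invSet σ).ncard := rfl

theorem adjSwap_lt (i : {i : ℕ // i + 1 < n}) (x y : Fin n) (hxy : x ≠ y)
    (h1 : ¬ ((x : ℕ) = i.1 ∧ (y : ℕ) = i.1 + 1)) (h2 : ¬ ((y : ℕ) = i.1 ∧ (x : ℕ) = i.1 + 1)) :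
    adjSwap i x < adjSwap i y ↔ x < y := by
  unfold adjSwap
  simp only [Equiv.swap_apply_def, Fin.ext_iff, Fin.lt_def] at *
  split_ifs <;> simp only <;> omega

theorem adjSwap_left (i : {i : ℕ // i + 1 < n}) :
    adjSwap i ⟨i.1, Nat.lt_of_succ_lt i.2⟩ = ⟨i.1 + 1, i.2⟩ := Equiv.swap_apply_left _ _

theorem adjSwap_right (i : {i : ℕ // i + 1 < n}) :
    adjSwap i ⟨i.1 + 1, i.2⟩ = ⟨i.1, Nat.lt_of_succ_lt i.2⟩ := Equiv.swap_apply_right _ _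

theorem inv_step (i : {i : ℕ // i + 1 < n}) (σ : Equiv.Perm (Fin n)) :
    (σ.symm ⟨i.1, Nat.lt_of_succ_lt i.2⟩ < σ.symm ⟨i.1 + 1, i.2⟩ ∧
      invSet (adjSwap i * σ) =
        insert (σ.symm ⟨i.1, Nat.lt_of_succ_lt i.2⟩, σ.symm ⟨i.1 + 1, i.2⟩) (invSet σ)) ∨
    invSet (adjSwap i * σ) ⊆ invSet σ := by
  set a := σ.symm ⟨i.1, Nat.lt_of_succ_lt i.2⟩ with ha
  set b := σ.symm ⟨i.1 + 1, i.2⟩ with hb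
  have sa : σ a = ⟨i.1, Nat.lt_of_succ_lt i.2⟩ := by simp [ha]
  have sb : σ b = ⟨i.1 + 1, i.2⟩ := by simp [hb]
  have hab : a ≠ b := by
    intro h
    rw [h, sb] at sa
    simpa using congrArg Fin.val sa
  have ka : ∀ x, (σ x : ℕ) = i.1 → x = a := fun x hx =>
    σ.injective (by rw [sa]; exact Fin.ext hx)
  have kb : ∀ x, (σ x : ℕ) = i.1 + 1 → x = b := fun x hx =>
    σ.injective (by rw [sb]; exact Fin.ext hx)
  have other : ∀ x y, x < y → ¬ (x = a ∧ y = b) → ¬ (x = b ∧ y = a) →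
      ((x, y) ∈ invSet (adjSwap i * σ) ↔ (x, y) ∈ invSet σ) := by
    intro x y hxy h1 h2
    simp only [invSet, Set.mem_setOf_eq, Equiv.Perm.mul_apply]
    rw [adjSwap_lt i (σ y) (σ x) (fun h => hxy.ne (σ.injective h).symm)]
    · rintro ⟨h3, h4⟩
      exact h2 ⟨kb _ h4, ka _ h3⟩
    · rintro ⟨h3, h4⟩
      exact h1 ⟨ka _ h3, kb _ h4⟩
  rcases lt_or_gt_of_ne hab with hlt | hlt
  · left
    refine ⟨hlt, ?_⟩
    ext ⟨x, y⟩
    by_cases h1 : x = a ∧ y = b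
    · obtain ⟨rfl, rfl⟩ := h1
      simp only [Set.mem_insert_iff, true_or, iff_true, invSet, Set.mem_setOf_eq,
        Equiv.Perm.mul_apply, sa, sb, adjSwap_left, adjSwap_right]
      exact ⟨hlt, by simp [Fin.lt_def]⟩
    · rw [Set.mem_insert_iff, Prod.mk.injEq, or_iff_right h1]
      by_cases hxy : x < y
      · refine other x y hxy h1 ?_
        rintro ⟨rfl, rfl⟩
        exact absurd hlt hxy.not_gt
      · simp [invSet, hxy]
  · right
    rintro ⟨x, y⟩ hm
    have hxy : x < y := hm.1
    by_cases h2 : x = b ∧ y = a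
    · exfalso
      obtain ⟨rfl, rfl⟩ := h2
      have := hm.2
      simp only [Equiv.Perm.mul_apply, sa, sb, adjSwap_left, adjSwap_right] at this
      simp [Fin.lt_def] at this
    · refine (other x y hxy ?_ h2).mp hm
      rintro ⟨rfl, rfl⟩
      exact absurd hlt hxy.not_gt

theorem permLength_step (i : {i : ℕ // i + 1 < n}) (σ : Equiv.Perm (Fin n)) :
    permLength (adjSwap i * σ) ≤ permLength σ + 1 := by
  rw [permLength_eq, permLength_eq]
  rcases inv_step i σ with ⟨_, h⟩ | h
  · rw [h]; exact Set.ncard_insert_le _ _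
  · exact (Set.ncard_le_ncard h (Set.toFinite _)).trans (Nat.le_succ _)

theorem permLength_one : permLength (1 : Equiv.Perm (Fin n)) = 0 := by
  rw [permLength_eq]
  have : invSet (1 : Equiv.Perm (Fin n)) = ∅ := by
    ext ⟨x, y⟩
    simp only [invSet, Set.mem_setOf_eq, Equiv.Perm.one_apply, Set.mem_empty_iff_false, iff_false]
    exact fun h => absurd h.1 h.2.not_gt
  rw [this, Set.ncard_empty]

theorem permLength_le (w : List {i : ℕ // i + 1 < n}) :
    permLength (w.map adjSwap).prod ≤ w.length := by
  induction w with
  | nil => simp [permLength_one]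
  | cons i w ih =>
    rw [List.map_cons, List.prod_cons, List.length_cons]
    exact (permLength_step _ _).trans (Nat.succ_le_succ ih)

theorem prod_pres (k : ℕ) (w : List {i : ℕ // i + 1 < n}) (hw : ∀ i ∈ w, i.1 + 1 ≠ k) (x : Fin n) :
    (((w.map adjSwap).prod x : Fin n) : ℕ) < k ↔ (x : ℕ) < k := by
  induction w with
  | nil => simp
  | cons i w ih =>
    rw [List.map_cons, List.prod_cons, Equiv.Perm.mul_apply,
      ← ih fun y hy => hw y (List.mem_cons_of_mem _ hy)]
    have hi := hw i List.mem_cons_self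
    generalize (w.map adjSwap).prod x = y
    unfold adjSwap
    simp only [Equiv.swap_apply_def, Fin.ext_iff]
    split_ifs <;> simp only <;> omega

theorem word_avoids (k : ℕ) (w : List {i : ℕ // i + 1 < n})
    (hl : w.length = permLength (w.map adjSwap).prod)
    (hc : ∀ p ∈ invSet (w.map adjSwap).prod, ¬ ((p.1 : ℕ) < k ∧ k ≤ (p.2 : ℕ))) :
    ∀ i ∈ w, i.1 + 1 ≠ k := by
  induction w with
  | nil => simp
  | cons i w ih =>
    rw [List.map_cons, List.prod_cons, List.length_cons] at hl
    rw [List.map_cons, List.prod_cons] at hc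
    have h1 := permLength_le w
    have h2 := permLength_step i (w.map adjSwap).prod
    rcases inv_step i (w.map adjSwap).prod with ⟨hlt, h⟩ | h
    · have ihw := ih (by omega) (fun p hp => hc p (by rw [h]; exact Set.mem_insert_of_mem _ hp))
      intro j hj
      rcases List.mem_cons.mp hj with rfl | hj
      · intro hk
        apply hc _ (by rw [h]; exact Set.mem_insert _ _)
        have p1 := prod_pres k w ihw
          ((w.map adjSwap).prod.symm ⟨j.1, Nat.lt_of_succ_lt j.2⟩)
        have p2 := prod_pres k w ihw
          ((w.map adjSwap).prod.symm ⟨j.1 + 1, j.2⟩)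
        rw [Equiv.apply_symm_apply] at p1 p2
        simp only at p1 p2 ⊢
        omega
      · exact ihw j hj
    · exfalso
      have := Set.ncard_le_ncard h (Set.toFinite _)
      rw [← permLength_eq, ← permLength_eq] at this
      omega

end words

theorem Tsigma_prod {n : ℕ} (k : ℕ) (c : K) (σ : Equiv.Perm (Fin n))
    (hσ : ∀ x, (σ x : ℕ) < k ↔ (x : ℕ) < k) (Q : MvPolynomial (Fin n) K) :
    ∃ Q' : MvPolynomial (Fin n) K, Q'.totalDegree = Q.totalDegree ∧
      Tsigma σ (prodk n k c * Q) = prodk n k c * Q' := by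
  unfold Tsigma
  split_ifs with h
  · obtain ⟨h1, h2⟩ := h.choose_spec
    have hav := word_avoids k h.choose (by rw [h1, h2]) (by
      rw [h1]
      rintro ⟨x, y⟩ ⟨_, hp⟩ ⟨hx, hy⟩
      have e1 := hσ x
      have e2 := hσ y
      simp only [Fin.lt_def] at *
      omega)
    obtain ⟨t1, t2⟩ := Tword_prod k c h.choose hav Q
    exact ⟨_, t2, t1⟩
  · exact ⟨Q, rfl, rfl⟩

theorem sortDesc_spec {n : ℕ} (μ : Fin n → ℕ) :
    IsPartition (sortDesc μ) ∧ ∃ σ : Equiv.Perm (Fin n), ∀ x, sortDesc μ x = μ (σ x) := by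
  have h : ∃ l, IsPartition l ∧ μ ∈ Sn l := by
    let e := Tuple.sort (fun i => OrderDual.toDual (μ i))
    have he := Tuple.monotone_sort (fun i => OrderDual.toDual (μ i))
    refine ⟨μ ∘ e, fun i j hij => he hij, e, ?_⟩
    funext x
    simp [permAct]
  unfold sortDesc
  rw [dif_pos h]
  obtain ⟨h1, σ, h2⟩ := h.choose_spec
  refine ⟨h1, σ, fun x => ?_⟩
  have := congrFun h2 (σ x)
  simpa [permAct] using this

theorem packed_sort {n k : ℕ} (hkn : k ≤ n) {μ l : Fin n → ℕ} (hμ : Packed k μ)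
    (hl : IsPartition l) (σ : Equiv.Perm (Fin n)) (h : ∀ x, l x = μ (σ x)) : Packed k l := by
  have hcard : (Finset.univ.filter (fun x => l x ≠ 0)).card = k := by
    have e1 : (Finset.univ.filter (fun x => l x ≠ 0)).card =
        (Finset.univ.filter (fun x : Fin n => (x:ℕ) < k)).card := by
      refine Finset.card_bij (fun x _ => σ x) ?_ (fun _ _ _ _ h => σ.injective h) ?_
      · intro x hx
        simp only [Finset.mem_filter, Finset.mem_univ, true_and] at hx ⊢
        rw [h] at hx
        by_contra hc
        exact hx ((hμ _).2 (by omega))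
      · intro y hy
        simp only [Finset.mem_filter, Finset.mem_univ, true_and] at hy
        refine ⟨σ.symm y, ?_, by simp⟩
        simp only [Finset.mem_filter, Finset.mem_univ, true_and, h, Equiv.apply_symm_apply]
        exact (hμ _).1 hy
    rw [e1, Fin.card_filter_val_lt, min_eq_right hkn]
  intro i
  constructor
  · intro hi h0
    have : (Finset.univ.filter (fun x => l x ≠ 0)) ⊆
        Finset.univ.filter (fun x : Fin n => (x:ℕ) < i) := by
      intro x hx
      simp only [Finset.mem_filter, Finset.mem_univ, true_and] at hx ⊢
      by_contra hc
      have := hl i x (by rw [Fin.le_def]; omega)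
      omega
    have := Finset.card_le_card this
    rw [hcard, Fin.card_filter_val_lt] at this
    omega
  · intro hi
    by_contra h0
    have : Finset.univ.filter (fun x : Fin n => (x:ℕ) < i + 1) ⊆
        (Finset.univ.filter (fun x => l x ≠ 0)) := by
      intro x hx
      simp only [Finset.mem_filter, Finset.mem_univ, true_and] at hx ⊢
      have := hl x i (by rw [Fin.le_def]; omega)
      omega
    have := Finset.card_le_card this
    rw [hcard, Fin.card_filter_val_lt] at this
    omega

theorem sigmaMin_pres {n k : ℕ} {μ l : Fin n → ℕ} (hμ : Packed k μ) (hl : Packed k l) (x : Fin n) :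
    (sigmaMin l μ x : ℕ) < k ↔ (x : ℕ) < k := by
  unfold sigmaMin
  split_ifs with h
  · have hs := h.choose_spec.1
    generalize h.choose = σ at hs ⊢
    have h1 : l x = μ (σ x) := by rw [← hs]; simp [permAct]
    have a1 := hμ (σ x)
    have a2 := hl x
    constructor
    · intro hx
      by_contra hc
      exact a1.1 hx (by rw [← h1]; exact a2.2 (by omega))
    · intro hx
      by_contra hc
      exact a2.1 hx (by rw [h1]; exact a1.2 (by omega))
  · simp

theorem prodk_degree {n k : ℕ} (hkn : k ≤ n) (c : K) :
    prodk n k c ≠ 0 ∧ (prodk n k c).totalDegree = k := by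
  have hX : ∀ i : Fin n, (X i - C c : MvPolynomial (Fin n) K) ≠ 0 := fun i =>
    (MonomialOrder.monic_X_sub_C MonomialOrder.lex i c).ne_zero
  have hXd : ∀ i : Fin n, (X i - C c : MvPolynomial (Fin n) K).totalDegree = 1 := by
    intro i
    apply le_antisymm ((totalDegree_sub_C_le _ _).trans (totalDegree_X_le _))
    have : (Finsupp.single i 1 : Fin n →₀ ℕ) ∈ (X i - C c : MvPolynomial (Fin n) K).support := by
      rw [mem_support_iff, coeff_sub, coeff_X, coeff_C, if_pos rfl, if_neg]
      · simp
      · intro h; simpa using DFunLike.congr_fun h i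
    simpa using le_totalDegree this
  refine ⟨Finset.prod_ne_zero_iff.mpr fun i _ => hX i, ?_⟩
  have gen : ∀ s : Finset (Fin n), (∏ i ∈ s, (X i - C c : MvPolynomial (Fin n) K)).totalDegree = s.card := by
    intro s
    induction s using Finset.induction_on with
    | empty => simp
    | insert a s ha ih =>
      rw [Finset.prod_insert ha, totalDegree_mul_of_isDomain (hX a)
        (Finset.prod_ne_zero_iff.mpr fun i _ => hX i), ih, hXd, Finset.card_insert_of_notMem ha]
      omega
  unfold prodk
  rw [gen, Fin.card_filter_val_lt, min_eq_right hkn]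

theorem Estar_spec {n : ℕ} (l : Fin n → ℕ) : IsEstar l (Estar l) := by
  have h := K_data.2.2.2 n l
  unfold Estar
  rw [dif_pos h]
  exact h.choose_spec

theorem Estar_factor {n k : ℕ} (hkn : k ≤ n + 1) {l : Fin (n+1) → ℕ} (hl : Packed k l) :
    ∃ Q : MvPolynomial (Fin (n+1)) K, Q.totalDegree = csize l - k ∧
      Estar l = prodk (n+1) k (tt⁻¹ ^ n) * Q := by
  obtain ⟨hd, hc, hv⟩ := Estar_spec l
  obtain ⟨ht, ⟨qi, hq⟩, hgen, _⟩ := K_data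
  obtain ⟨Q, hQ⟩ := interp_dvd hq hgen n k (csize l) (Estar l) hkn hd (by
    rintro ν hν ⟨i, hi, h0⟩
    rw [← evalPt_eq]
    refine hv ν hν ?_
    rintro rfl
    exact (hl i).1 hi h0)
  have hdeg : (Estar l).totalDegree = csize l := by
    apply le_antisymm hd
    have : expOf l ∈ (Estar l).support := by rw [mem_support_iff, hc]; exact one_ne_zero
    have := le_totalDegree this
    rw [Finsupp.sum_fintype _ _ (fun _ => rfl)] at this
    exact this
  have hQ0 : Q ≠ 0 := by
    rintro rfl
    rw [hQ, mul_zero, coeff_zero] at hc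
    exact zero_ne_one hc
  refine ⟨Q, ?_, hQ⟩
  obtain ⟨p1, p2⟩ := prodk_degree hkn (tt⁻¹ ^ n)
  rw [hQ, totalDegree_mul_of_isDomain p1 hQ0, p2] at hdeg
  omega

/-- factorization of `f*_μ` for packed `μ`. -/
theorem statement11 (n k : ℕ) (hk1 : 1 ≤ k) (hkn : k ≤ n)
    (μ : Fin n → ℕ) (hμ : Packed k μ) :
    ∃ Q : MvPolynomial (Fin n) K,
      Q.totalDegree = csize μ - k ∧
      fstar μ = (∏ i ∈ Finset.univ.filter (fun i : Fin n => (i : ℕ) < k),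
        (X i - C (tt ^ (-(n : ℤ) + 1)))) * Q := by
  obtain ⟨n, rfl⟩ : ∃ m, n = m + 1 := ⟨n - 1, by omega⟩
  obtain ⟨hp, σ, hσ⟩ := sortDesc_spec μ
  have hl : Packed k (sortDesc μ) := packed_sort hkn hμ hp σ hσ
  have hsize : csize (sortDesc μ) = csize μ := by
    unfold csize
    simp only [hσ]
    exact Equiv.sum_comp σ μ
  obtain ⟨Q, hQd, hQ⟩ := Estar_factor hkn hl
  obtain ⟨Q', hQ'd, hQ'⟩ := Tsigma_prod k (tt⁻¹ ^ n) (sigmaMin (sortDesc μ) μ)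
    (sigmaMin_pres hμ hl) Q
  refine ⟨Q', by rw [hQ'd, hQd, hsize], ?_⟩
  have hc : (tt ^ (-((n + 1 : ℕ) : ℤ) + 1) : K) = tt⁻¹ ^ n := by
    rw [show (-((n + 1 : ℕ) : ℤ) + 1) = -(n : ℤ) by push_cast; ring, zpow_neg, zpow_natCast, inv_pow]
  rw [hc]
  unfold fstar
  rw [hQ, hQ']
  rfl
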